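/- Let m > 0 and let u \neq 0 be real. Then there exists a > 0 such that, with x := 4u^2m^2 - 4a^2: x > -\pi^2, the inequality 4u^2m^2 + 4a^2 m < C(x)/(2 S'(x)) holds (so that both (u,a) and (-u,a) satisfy the defining conditions of the slice \Sigma_m of the maximal adapted complexification), and \Phi_m(u,a) = \Phi_m(-u,a), i.e. e^{-2u(1+m)}(C(x) + 2umS(x)) = e^{2u(1+m)}(C(x) - 2umS(x)). In particular for m > 0 the map \Phi_m is not injective on this set, so the polar map P_m of the maximal adapted complexification of (SL_2(\mathbb{R}), \nu_m) is not injective. -/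

import Mathlib

open Real

/-- `C x = ∑ xⁿ/(2n)!`, i.e. `cosh √x` for `x ≥ 0` and `cos √(-x)` for `x ≤ 0`. -/
noncomputable def C (x : ℝ) : ℝ := ∑' n : ℕ, x ^ n / (Nat.factorial (2 * n))

/-- `S x = ∑ xⁿ/(2n+1)!`, i.e. `sinh √x/√x` for `x > 0` and `sin √(-x)/√(-x)` for `x < 0`. -/
noncomputable def S (x : ℝ) : ℝ := ∑' n : ℕ, x ^ n / (Nat.factorial (2 * n + 1))

/-- The reduced polar map `Φₘ = P̂ₘ` of the metric `νₘ` on `SL₂(ℝ)` in the slice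
coordinates `(u, a)`, with `x = 4u²m² - 4a²`. -/
noncomputable def Phi (m : ℝ) (p : ℝ × ℝ) : ℝ × ℝ :=
  (Real.exp (-(2 * p.1 * (1 + m))) *
      (C (4 * p.1 ^ 2 * m ^ 2 - 4 * p.2 ^ 2) +
        2 * p.1 * m * S (4 * p.1 ^ 2 * m ^ 2 - 4 * p.2 ^ 2)),
   Real.exp (2 * p.1 * (1 + m)) *
      (C (4 * p.1 ^ 2 * m ^ 2 - 4 * p.2 ^ 2) -
        2 * p.1 * m * S (4 * p.1 ^ 2 * m ^ 2 - 4 * p.2 ^ 2)))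

/-- A power series with coefficients `1 / (f n)!`, `f` strictly increasing, is entire. -/
theorem hasFPowerSeriesOnBall_inv_factorial {f : ℕ → ℕ} (hf : StrictMono f) :
    HasFPowerSeriesOnBall (fun x : ℝ => ∑' n : ℕ, x ^ n / (Nat.factorial (f n)))
      (FormalMultilinearSeries.ofScalars ℝ fun n => ((Nat.factorial (f n) : ℝ))⁻¹) 0 ⊤ := by
  set c : ℕ → ℝ := fun n => ((Nat.factorial (f n) : ℝ))⁻¹ with hc
  have hrad : (FormalMultilinearSeries.ofScalars ℝ c).radius = ⊤ := by
    refine FormalMultilinearSeries.radius_eq_top_of_summable_norm _ fun r => ?_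
    refine Summable.of_nonneg_of_le (fun n => by positivity) (fun n => ?_)
      (Real.summable_pow_div_factorial (r : ℝ))
    rw [FormalMultilinearSeries.ofScalars_norm, hc, Real.norm_of_nonneg (by positivity),
      mul_comm, ← div_eq_mul_inv]
    have : (Nat.factorial n : ℝ) ≤ Nat.factorial (f n) := by
      exact_mod_cast Nat.factorial_le (hf.id_le n)
    gcongr
  have h := (FormalMultilinearSeries.ofScalars ℝ c).hasFPowerSeriesOnBall (by simp [hrad])
  rw [hrad] at h
  refine h.congr fun x _ => ?_
  change FormalMultilinearSeries.ofScalarsSum c x = _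
  rw [FormalMultilinearSeries.ofScalars_sum_eq]
  exact tsum_congr fun n => by rw [smul_eq_mul, hc, mul_comm, ← div_eq_mul_inv]

theorem hasFPowerSeriesOnBall_C :
    HasFPowerSeriesOnBall C
      (FormalMultilinearSeries.ofScalars ℝ fun n => ((Nat.factorial (2 * n) : ℝ))⁻¹) 0 ⊤ :=
  hasFPowerSeriesOnBall_inv_factorial (f := fun n => 2 * n) fun _ _ h => by
    change 2 * _ < 2 * _; omega

theorem hasFPowerSeriesOnBall_S :
    HasFPowerSeriesOnBall S
      (FormalMultilinearSeries.ofScalars ℝ fun n => ((Nat.factorial (2 * n + 1) : ℝ))⁻¹) 0 ⊤ :=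
  hasFPowerSeriesOnBall_inv_factorial (f := fun n => 2 * n + 1) fun _ _ h => by
    change 2 * _ + 1 < 2 * _ + 1; omega

theorem differentiable_C : Differentiable ℝ C := fun x =>
  (hasFPowerSeriesOnBall_C.analyticAt_of_mem (by simp)).differentiableAt

theorem differentiable_S : Differentiable ℝ S := fun x =>
  (hasFPowerSeriesOnBall_S.analyticAt_of_mem (by simp)).differentiableAt

theorem C_zero : C 0 = 1 := by
  rw [C, tsum_eq_single 0 (fun n hn => by simp [hn])]; simp

theorem S_zero : S 0 = 1 := by
  rw [S, tsum_eq_single 0 (fun n hn => by simp [hn])]; simp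

theorem deriv_S_zero : deriv S 0 = 1 / 6 := by
  rw [hasFPowerSeriesOnBall_S.hasFPowerSeriesAt.deriv,
    FormalMultilinearSeries.ofScalars_apply_eq]
  norm_num [Nat.factorial]

theorem C_sq (r : ℝ) : C (r ^ 2) = cosh r := by
  rw [C, Real.cosh_eq_tsum]
  simp_rw [pow_mul]

theorem mul_S_sq (r : ℝ) : r * S (r ^ 2) = sinh r := by
  rw [S, Real.sinh_eq_tsum, ← tsum_mul_left]
  exact tsum_congr fun n => by rw [pow_succ r (2 * n), pow_mul]; ring

theorem C_neg_sq (r : ℝ) : C (-r ^ 2) = cos r := by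
  rw [C, Real.cos_eq_tsum]
  exact tsum_congr fun n => by rw [neg_pow, pow_mul]

theorem mul_S_neg_sq (r : ℝ) : r * S (-r ^ 2) = sin r := by
  rw [S, Real.sin_eq_tsum, ← tsum_mul_left]
  exact tsum_congr fun n => by rw [neg_pow (r ^ 2), pow_succ r (2 * n), pow_mul]; ring

/-- The differential relation `2 x S'(x) = C(x) - S(x)`. -/
theorem two_mul_mul_deriv_S (x : ℝ) : 2 * x * deriv S x = C x - S x := by
  rcases lt_trichotomy x 0 with hx | rfl | hx
  · obtain ⟨r, hr, rfl⟩ : ∃ r : ℝ, 0 < r ∧ x = -r ^ 2 :=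
      ⟨√(-x), by simpa using hx, by rw [Real.sq_sqrt (by linarith)]; ring⟩
    have h1 : HasDerivAt (fun t : ℝ => t * S (-t ^ 2))
        (1 * S (-r ^ 2) + r * (deriv S (-r ^ 2) * (-(2 * r)))) r := by
      have h0 : HasDerivAt (fun t : ℝ => -t ^ 2) (-(2 * r)) r := by
        simpa using (hasDerivAt_pow 2 r).fun_neg
      exact (hasDerivAt_id r).mul
        (HasDerivAt.comp r (h₂ := S) (differentiable_S (-r ^ 2)).hasDerivAt h0)
    have h2 : (fun t : ℝ => t * S (-t ^ 2)) = sin := funext mul_S_neg_sq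
    rw [h2] at h1
    have h3 := h1.unique (Real.hasDerivAt_sin r)
    rw [C_neg_sq]
    linarith
  · simp [C_zero, S_zero]
  · obtain ⟨r, hr, rfl⟩ : ∃ r : ℝ, 0 < r ∧ x = r ^ 2 :=
      ⟨√x, by simpa using hx, by rw [Real.sq_sqrt hx.le]⟩
    have h1 : HasDerivAt (fun t : ℝ => t * S (t ^ 2))
        (1 * S (r ^ 2) + r * (deriv S (r ^ 2) * (2 * r))) r := by
      have h0 : HasDerivAt (fun t : ℝ => t ^ 2) (2 * r) r := by
        simpa using hasDerivAt_pow 2 r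
      exact (hasDerivAt_id r).mul
        (HasDerivAt.comp r (h₂ := S) (differentiable_S (r ^ 2)).hasDerivAt h0)
    have h2 : (fun t : ℝ => t * S (t ^ 2)) = sinh := funext mul_S_sq
    rw [h2] at h1
    have h3 := h1.unique (Real.hasDerivAt_sinh r)
    rw [C_sq]
    linarith

/-- The Cusa–Huygens inequality, in non-strict form. -/
theorem three_mul_sin_le {t : ℝ} (h0 : 0 ≤ t) (hpi : t ≤ π) : 3 * sin t ≤ t * (2 + cos t) := by
  have hd : ∀ x : ℝ, HasDerivAt (fun x => x * (2 + cos x) - 3 * sin x)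
      (1 * (2 + cos x) + x * (-sin x) - 3 * cos x) x := fun x =>
    ((hasDerivAt_id x).mul ((Real.hasDerivAt_cos x).const_add 2)).sub
      ((Real.hasDerivAt_sin x).const_mul 3)
  have hm : MonotoneOn (fun x => x * (2 + cos x) - 3 * sin x) (Set.Icc 0 π) := by
    refine monotoneOn_of_deriv_nonneg (convex_Icc 0 π)
      (fun x _ => (hd x).continuousAt.continuousWithinAt)
      (fun x _ => (hd x).differentiableAt.differentiableWithinAt) fun x hx => ?_
    rw [interior_Icc] at hx
    obtain ⟨hx0, hx1⟩ := hx
    rw [(hd x).deriv]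
    obtain ⟨h, rfl⟩ : ∃ h, x = 2 * h := ⟨x / 2, by ring⟩
    have hs : 0 < sin h := Real.sin_pos_of_pos_of_lt_pi (by linarith) (by linarith)
    have hc : 0 < cos h := Real.cos_pos_of_mem_Ioo ⟨by linarith, by linarith⟩
    have ht : h * cos h < sin h := by
      have := Real.lt_tan (x := h) (by linarith) (by linarith)
      rwa [Real.tan_eq_sin_div_cos, lt_div_iff₀ hc] at this
    have e : 1 * (2 + cos (2 * h)) + 2 * h * (-sin (2 * h)) - 3 * cos (2 * h)
        = 4 * sin h * (sin h - h * cos h) := by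
      rw [Real.sin_two_mul, Real.cos_two_mul, Real.cos_sq']; ring
    rw [e]
    exact mul_nonneg (by linarith) (by linarith)
  have := hm ⟨le_rfl, Real.pi_pos.le⟩ ⟨h0, hpi⟩ h0
  simp only [zero_mul, Real.sin_zero, mul_zero, sub_zero] at this
  linarith

theorem sinh_lt_mul_cosh {r : ℝ} (hr : 0 < r) : sinh r < r * cosh r := by
  have hd : ∀ x : ℝ, HasDerivAt (fun x => x * cosh x - sinh x)
      (1 * cosh x + x * sinh x - cosh x) x := fun x =>
    ((hasDerivAt_id x).mul (Real.hasDerivAt_cosh x)).sub (Real.hasDerivAt_sinh x)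
  have hm : StrictMonoOn (fun x => x * cosh x - sinh x) (Set.Ici 0) := by
    refine strictMonoOn_of_deriv_pos (convex_Ici 0)
      (fun x _ => (hd x).continuousAt.continuousWithinAt) fun x hx => ?_
    rw [interior_Ici] at hx
    rw [(hd x).deriv]
    have := mul_pos hx (Real.sinh_pos_iff.2 hx)
    linarith
  have := hm Set.self_mem_Ici hr.le hr
  simp only [zero_mul, Real.sinh_zero, sub_zero] at this
  linarith

theorem C_pos {x : ℝ} (hx : -(π / 2) ^ 2 < x) : 0 < C x := by
  rcases le_or_gt 0 x with h | h
  · rw [← Real.sq_sqrt h, C_sq]; exact Real.cosh_pos _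
  · have e : x = -√(-x) ^ 2 := by rw [Real.sq_sqrt (by linarith)]; ring
    rw [e, C_neg_sq]
    refine Real.cos_pos_of_mem_Ioo ⟨?_, ?_⟩
    · linarith [Real.sqrt_nonneg (-x), Real.pi_pos]
    · rw [Real.sqrt_lt' (by positivity)]; linarith

theorem deriv_S_pos {x : ℝ} (hx : -(π / 2) ^ 2 < x) : 0 < deriv S x := by
  have h2 := two_mul_mul_deriv_S x
  rcases lt_trichotomy x 0 with h | rfl | h
  · obtain ⟨r, hr, rfl⟩ : ∃ r : ℝ, 0 < r ∧ x = -r ^ 2 :=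
      ⟨√(-x), by simpa using h, by rw [Real.sq_sqrt (by linarith)]; ring⟩
    have hr2 : r < π / 2 := by
      refine lt_of_pow_lt_pow_left₀ 2 (by positivity) (by linarith)
    have hS := mul_S_neg_sq r
    have hC := C_pos hx
    have ht := Real.lt_tan hr hr2
    rw [C_neg_sq] at h2 hC
    rw [Real.tan_eq_sin_div_cos, lt_div_iff₀ hC, ← hS, mul_lt_mul_iff_right₀ hr] at ht
    by_contra! hd
    nlinarith [mul_nonneg (sq_nonneg r) (neg_nonneg.2 hd)]
  · rw [deriv_S_zero]; norm_num
  · obtain ⟨r, hr, rfl⟩ : ∃ r : ℝ, 0 < r ∧ x = r ^ 2 :=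
      ⟨√x, by simpa using h, by rw [Real.sq_sqrt h.le]⟩
    have hS := mul_S_sq r
    have ht := sinh_lt_mul_cosh hr
    rw [C_sq] at h2
    rw [← hS, mul_lt_mul_iff_right₀ hr] at ht
    by_contra! hd
    nlinarith [mul_nonneg (sq_nonneg r) (neg_nonneg.2 hd)]

/-- On the nonpositive axis down to the first zero of `C` one has `6 S' C ≤ S²`. -/
theorem six_mul_deriv_S_mul_C_le {x : ℝ} (hx : -(π / 2) ^ 2 < x) (h0 : x ≤ 0) :
    6 * deriv S x * C x ≤ S x ^ 2 := by
  have h2 := two_mul_mul_deriv_S x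
  rcases h0.lt_or_eq with h | rfl
  · obtain ⟨r, hr, rfl⟩ : ∃ r : ℝ, 0 < r ∧ x = -r ^ 2 :=
      ⟨√(-x), by simpa using h, by rw [Real.sq_sqrt (by linarith)]; ring⟩
    have hr2 : r < π / 2 := by
      refine lt_of_pow_lt_pow_left₀ 2 (by positivity) (by linarith)
    have hS := mul_S_neg_sq r
    have hc := three_mul_sin_le (t := 2 * r) (by linarith) (by linarith)
    rw [Real.sin_two_mul, Real.cos_two_mul] at hc
    rw [C_neg_sq] at h2 ⊢
    have hsc := Real.sin_sq_add_cos_sq r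
    rw [← hS] at hc hsc
    have h3 : 3 * S (-r ^ 2) * cos r ≤ 1 + 2 * cos r ^ 2 := by
      refine le_of_mul_le_mul_left ?_ (by linarith : 0 < 2 * r)
      linarith
    refine le_of_mul_le_mul_left ?_ (by positivity : 0 < r ^ 2)
    have h4 : r ^ 2 * (6 * deriv S (-r ^ 2) * cos r) = 3 * (S (-r ^ 2) - cos r) * cos r := by
      linear_combination (-3 * cos r) * h2
    rw [h4]
    linarith
  · rw [deriv_S_zero, C_zero, S_zero]; norm_num

/-- If `sinh k cosh k ≤ k (cosh² k - β sinh² k)` holds at `a ≥ 0`, then it holds strictly at every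
`k > a`; for `a = 0` this requires `β ≤ 1 / 3`. -/
theorem sinh_mul_cosh_lt {β a k : ℝ} (hβ1 : β < 1) (ha : 0 ≤ a) (hk : a < k)
    (h0 : a = 0 → 3 * β ≤ 1)
    (hq : sinh a * cosh a ≤ a * (cosh a ^ 2 - β * sinh a ^ 2)) :
    sinh k * cosh k < k * (cosh k ^ 2 - β * sinh k ^ 2) := by
  have hD : ∀ x, 0 < cosh x ^ 2 - β * sinh x ^ 2 := fun x => by
    rw [Real.cosh_sq]; nlinarith [mul_nonneg (sub_nonneg.2 hβ1.le) (sq_nonneg (sinh x))]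
  set q : ℝ → ℝ := fun x => x - sinh x * cosh x / (cosh x ^ 2 - β * sinh x ^ 2) with hqdef
  have hd : ∀ x, HasDerivAt q (sinh x ^ 2 * (1 - 3 * β + (1 - β) ^ 2 * sinh x ^ 2) /
      (cosh x ^ 2 - β * sinh x ^ 2) ^ 2) x := fun x => by
    have h1 := (Real.hasDerivAt_sinh x).mul (Real.hasDerivAt_cosh x)
    have h2 := ((Real.hasDerivAt_cosh x).pow 2).sub
      (((Real.hasDerivAt_sinh x).pow 2).const_mul β)
    have h3 := (hasDerivAt_id x).sub (h1.div h2 (hD x).ne')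
    convert! h3 using 1
    have := (hD x).ne'
    have hc := Real.cosh_sq x
    simp only [Pi.mul_apply, Pi.sub_apply, Pi.pow_apply]
    rw [eq_sub_iff_add_eq, ← add_div, div_eq_one_iff_eq (pow_ne_zero 2 this)]
    have hc4 : cosh x ^ 4 = (sinh x ^ 2 + 1) ^ 2 := by rw [← hc]; ring
    ring_nf
    simp only [hc, hc4]
    ring
  have hq_pos : ∀ x, 0 < q x ↔ sinh x * cosh x < x * (cosh x ^ 2 - β * sinh x ^ 2) := fun x => by
    rw [hqdef, sub_pos, div_lt_iff₀ (hD x)]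
  have hqa : 0 ≤ q a := by
    rw [hqdef, sub_nonneg, div_le_iff₀ (hD a)]; exact hq
  have hcont : Continuous q := continuous_iff_continuousAt.2 fun x => (hd x).continuousAt
  have hL : 0 ≤ 1 - 3 * β + (1 - β) ^ 2 * sinh a ^ 2 := by
    rcases ha.eq_or_lt with rfl | ha'
    · simpa using h0 rfl
    by_contra! hneg
    have hanti : StrictAntiOn q (Set.Icc 0 a) := by
      refine strictAntiOn_of_deriv_neg (convex_Icc 0 a) hcont.continuousOn fun x hx => ?_
      rw [interior_Icc] at hx
      rw [(hd x).deriv]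
      have hs : 0 < sinh x := Real.sinh_pos_iff.2 hx.1
      have hsa : sinh x < sinh a := Real.sinh_lt_sinh.2 hx.2
      refine div_neg_of_neg_of_pos (mul_neg_of_pos_of_neg (by positivity) ?_) (pow_pos (hD x) 2)
      refine lt_of_le_of_lt ?_ hneg
      gcongr
    have := hanti ⟨le_rfl, ha⟩ ⟨ha, le_rfl⟩ ha'
    simp only [hqdef, Real.sinh_zero, zero_mul, zero_div, sub_zero] at this
    exact absurd hqa (not_le.2 this)
  have hmono : StrictMonoOn q (Set.Ici a) := by
    refine strictMonoOn_of_deriv_pos (convex_Ici a) hcont.continuousOn fun x hx => ?_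
    rw [interior_Ici] at hx
    rw [(hd x).deriv]
    have hs : 0 < sinh x := Real.sinh_pos_iff.2 (ha.trans_lt hx)
    have hsa : sinh a < sinh x := Real.sinh_lt_sinh.2 hx
    have hsa0 : 0 ≤ sinh a := Real.sinh_nonneg_iff.2 ha
    have hβ : 0 < 1 - β := by linarith
    refine div_pos (mul_pos (by positivity) (hL.trans_lt ?_)) (pow_pos (hD x) 2)
    gcongr
  exact (hq_pos k).1 (hqa.trans_lt (hmono Set.self_mem_Ici hk.le hk))

/-- The slice inequality along the solution curve `v S(x) cosh k = C(x) sinh k`. -/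
theorem mul_S_lt_of_mul_cosh_eq {x v k : ℝ} (hx : -(π / 2) ^ 2 < x) (hxv : x < v ^ 2)
    (hv : 0 < v) (hvk : v < k) (hSx : 0 < S x) (heq : v * S x * cosh k = C x * sinh k) :
    v * S x < k * (C x - 2 * deriv S x * v ^ 2) := by
  have hC := C_pos hx
  have hd := deriv_S_pos hx
  set β := 2 * deriv S x * C x / S x ^ 2 with hβ
  have hβS : β * S x ^ 2 = 2 * deriv S x * C x := by rw [hβ]; field_simp
  have key : sinh k * cosh k < k * (cosh k ^ 2 - β * sinh k ^ 2) := by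
    rcases le_or_gt x 0 with h | h
    · have h3 : 3 * β ≤ 1 := by
        have := six_mul_deriv_S_mul_C_le hx h
        rw [hβ, ← mul_div_assoc, div_le_one (by positivity)]
        linarith
      exact sinh_mul_cosh_lt (a := 0) (by linarith) le_rfl (by linarith) (fun _ => h3) (by simp)
    · obtain ⟨r, hr, rfl⟩ : ∃ r : ℝ, 0 < r ∧ x = r ^ 2 :=
        ⟨√x, by simpa using h, by rw [Real.sq_sqrt h.le]⟩
      have hrv : r < v := lt_of_pow_lt_pow_left₀ 2 hv.le hxv
      have hS := mul_S_sq r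
      have h2 := two_mul_mul_deriv_S (r ^ 2)
      have hC2 := C_sq r
      have hs : 0 < sinh r := Real.sinh_pos_iff.2 hr
      have e : β * sinh r ^ 2 = C (r ^ 2) * (C (r ^ 2) - S (r ^ 2)) := by
        rw [← hS, mul_pow]
        linear_combination r ^ 2 * hβS + C (r ^ 2) * h2
      have hSC : 1 < C (r ^ 2) * S (r ^ 2) := by
        have h1 : r < sinh r := Real.self_lt_sinh_iff.2 hr
        have h2 : 1 < S (r ^ 2) := by
          rw [← hS] at h1
          exact lt_of_mul_lt_mul_left (by linarith) hr.le
        rw [hC2]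
        nlinarith [Real.one_le_cosh r]
      refine sinh_mul_cosh_lt (a := r) ?_ hr.le (hrv.trans hvk) (fun h => absurd h hr.ne') ?_
      · refine lt_of_mul_lt_mul_right ?_ (sq_nonneg (sinh r))
        rw [e, one_mul, Real.sinh_sq, ← hC2]
        linarith
      · rw [e, ← hC2, ← hS]
        exact le_of_eq (by ring)
  have hc := Real.cosh_pos k
  refine lt_of_mul_lt_mul_left ?_ (by positivity : 0 ≤ C x * (cosh k ^ 2))
  have e1 : C x * cosh k ^ 2 * (v * S x) = C x ^ 2 * (sinh k * cosh k) := by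
    linear_combination C x * cosh k * heq
  have e2 : C x * cosh k ^ 2 * (k * (C x - 2 * deriv S x * v ^ 2)) =
      C x ^ 2 * (k * (cosh k ^ 2 - β * sinh k ^ 2)) := by
    linear_combination k * v ^ 2 * cosh k ^ 2 * hβS -
      k * β * (v * S x * cosh k + C x * sinh k) * heq
  rw [e1, e2]
  gcongr

theorem S_pos {x : ℝ} (hx : -(π / 2) ^ 2 < x) : 0 < S x := by
  rcases lt_trichotomy x 0 with h | rfl | h
  · have := two_mul_mul_deriv_S x
    nlinarith [C_pos hx, mul_pos (neg_pos.2 h) (deriv_S_pos hx)]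
  · rw [S_zero]; exact one_pos
  · refine pos_of_mul_pos_right ?_ (Real.sqrt_nonneg x)
    have h1 := mul_S_sq √x
    rw [Real.sq_sqrt h.le] at h1
    rw [h1]
    exact Real.sinh_pos_iff.2 (Real.sqrt_pos.2 h)

/-- For `0 < v < k` the equation `v S(x) cosh k = C(x) sinh k` has a solution in
`(-(π / 2)², v²)`. -/
theorem exists_mul_S_mul_cosh_eq {v k : ℝ} (hv : 0 < v) (hvk : v < k) :
    ∃ x, -(π / 2) ^ 2 < x ∧ x < v ^ 2 ∧ v * S x * cosh k = C x * sinh k := by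
  have hcont : Continuous fun x => v * S x * cosh k - C x * sinh k := by
    have := differentiable_S.continuous
    have := differentiable_C.continuous
    fun_prop
  have hle : -(π / 2) ^ 2 ≤ v ^ 2 := by nlinarith [sq_nonneg (π / 2), sq_nonneg v]
  have hleft : 0 < v * S (-(π / 2) ^ 2) * cosh k - C (-(π / 2) ^ 2) * sinh k := by
    have h1 := mul_S_neg_sq (π / 2)
    rw [Real.sin_pi_div_two] at h1
    have h2 : 0 < S (-(π / 2) ^ 2) :=
      pos_of_mul_pos_right (by rw [h1]; exact one_pos) (by positivity : 0 ≤ π / 2)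
    rw [C_neg_sq, Real.cos_pi_div_two]
    have := Real.cosh_pos k
    simp only [zero_mul, sub_zero]
    positivity
  have hright : v * S (v ^ 2) * cosh k - C (v ^ 2) * sinh k < 0 := by
    rw [mul_S_sq, C_sq, ← Real.sinh_sub]
    exact Real.sinh_neg_iff.2 (by linarith)
  obtain ⟨x, hx, hx0⟩ := intermediate_value_Ioo' hle hcont.continuousOn ⟨hright, hleft⟩
  exact ⟨x, hx.1, hx.2, by simpa [sub_eq_zero] using hx0⟩

theorem exists_slice_point_of_pos (m u : ℝ) (hm : 0 < m) (hu : 0 < u) :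
    ∃ a : ℝ, 0 < a ∧
      4 * u ^ 2 * m ^ 2 - 4 * a ^ 2 > -π ^ 2 ∧
      4 * u ^ 2 * m ^ 2 + 4 * a ^ 2 * m <
        C (4 * u ^ 2 * m ^ 2 - 4 * a ^ 2) /
          (2 * deriv S (4 * u ^ 2 * m ^ 2 - 4 * a ^ 2)) ∧
      Phi m (u, a) = Phi m (-u, a) := by
  have hv : 0 < 2 * u * m := by positivity
  have hvk : 2 * u * m < 2 * u * (1 + m) := by linarith
  obtain ⟨x, hx, hxv, heq⟩ := exists_mul_S_mul_cosh_eq hv hvk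
  have hlt := mul_S_lt_of_mul_cosh_eq hx hxv hv hvk (S_pos hx) heq
  have hd := deriv_S_pos hx
  have hrel := two_mul_mul_deriv_S x
  have ha2 : √(((2 * u * m) ^ 2 - x) / 4) ^ 2 = ((2 * u * m) ^ 2 - x) / 4 :=
    Real.sq_sqrt (by linarith)
  have hxa : 4 * u ^ 2 * m ^ 2 - 4 * √(((2 * u * m) ^ 2 - x) / 4) ^ 2 = x := by
    rw [ha2]; ring
  refine ⟨√(((2 * u * m) ^ 2 - x) / 4), Real.sqrt_pos.2 (by linarith), ?_, ?_, ?_⟩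
  · rw [hxa]; nlinarith [Real.pi_pos]
  · rw [hxa, ha2, lt_div_iff₀ (by positivity)]
    refine lt_of_mul_lt_mul_left ?_ (by positivity : 0 ≤ 2 * u)
    linear_combination hlt - 2 * u * m * hrel
  · have hexp : exp (-(2 * u * (1 + m))) * (C x + 2 * u * m * S x) =
        exp (2 * u * (1 + m)) * (C x - 2 * u * m * S x) := by
      rw [Real.cosh_eq, Real.sinh_eq] at heq
      linear_combination 2 * heq
    simp only [Phi, neg_sq, hxa, mul_neg, neg_mul, neg_neg, sub_neg_eq_add, ← sub_eq_add_neg]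
    rw [hexp]

/-- For `m > 0` and `u ≠ 0` there exists `a > 0` such that, with `x = 4u²m² - 4a²`,
one has `x > -π²`, the slice condition `4u²m² + 4a²m < C(x)/(2S'(x))` (so both `(u,a)` and
`(-u,a)` lie in the defining conditions of `Σₘ`), and `Φₘ(u,a) = Φₘ(-u,a)`.
In particular for `m > 0` the reduced polar map is not injective, hence neither is `Pₘ`. -/
theorem stmt19 (m u : ℝ) (hm : 0 < m) (hu : u ≠ 0) :
    ∃ a : ℝ, 0 < a ∧
      4 * u ^ 2 * m ^ 2 - 4 * a ^ 2 > -π ^ 2 ∧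
      4 * u ^ 2 * m ^ 2 + 4 * a ^ 2 * m <
        C (4 * u ^ 2 * m ^ 2 - 4 * a ^ 2) /
          (2 * deriv S (4 * u ^ 2 * m ^ 2 - 4 * a ^ 2)) ∧
      Phi m (u, a) = Phi m (-u, a) := by
  rcases lt_or_gt_of_ne hu with h | h
  · obtain ⟨a, ha, h1, h2, h3⟩ := exists_slice_point_of_pos m (-u) hm (neg_pos.2 h)
    rw [neg_sq] at h1 h2
    rw [neg_neg] at h3
    exact ⟨a, ha, h1, h2, h3.symm⟩
  · exact exists_slice_point_of_pos m u hm h
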